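/- Let X be a Polish space without isolated points, and A ⊆ B ⊆ C ⊆ X with A an F_σ-set, B non-empty regular closed, and C closed. Then there exists a sequence x in X such that the set of statistical limit points of x is A, the set of statistical cluster points of x is B, and the set of ordinary limit points of x is C. -/

import Mathlib

open Filter Topology Set
open scoped ENNReal

/-- An ideal on ℕ: contains all finite sets, closed under subsets and finite
unions, and proper. -/
def IsIdeal (I : Set (Set ℕ)) : Prop :=
  (∀ A : Set ℕ, A.Finite → A ∈ I) ∧
  (∀ A B : Set ℕ, A ⊆ B → B ∈ I → A ∈ I) ∧
  (∀ A B : Set ℕ, A ∈ I → B ∈ I → A ∪ B ∈ I) ∧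
  (Set.univ : Set ℕ) ∉ I

/-- `ℓ` is an `I`-limit point of `x`: some subsequence indexed by a set not in
`I` converges to `ℓ`. -/
def ILimitPoint {X : Type*} [TopologicalSpace X] (I : Set (Set ℕ)) (x : ℕ → X) (ℓ : X) : Prop :=
  ∃ A : Set ℕ, A ∉ I ∧ Tendsto x (atTop ⊓ 𝓟 A) (𝓝 ℓ)

/-- `ℓ` is an `I`-cluster point of `x`. -/
def IClusterPoint {X : Type*} [TopologicalSpace X] (I : Set (Set ℕ)) (x : ℕ → X) (ℓ : X) : Prop :=
  ∀ U ∈ 𝓝 ℓ, {n | x n ∈ U} ∉ I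

/-- A lower semicontinuous submeasure on ℕ. -/
def IsLSCSubmeasure (φ : Set ℕ → ℝ≥0∞) : Prop :=
  φ ∅ = 0 ∧ (∀ A B : Set ℕ, A ⊆ B → φ A ≤ φ B) ∧
  (∀ A B : Set ℕ, φ (A ∪ B) ≤ φ A + φ B) ∧
  (∀ A : Set ℕ, Tendsto (fun n => φ (A ∩ Set.Iio n)) atTop (𝓝 (φ A)))

/-- `‖A‖_φ = lim_n φ(A \ {0,…,n-1})`, the limit of an antitone sequence,
realized as an infimum. -/
noncomputable def phiNorm (φ : Set ℕ → ℝ≥0∞) (A : Set ℕ) : ℝ≥0∞ :=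
  ⨅ n : ℕ, φ (A \ Set.Iio n)

/-- The ideal of sets of asymptotic density zero. -/
def I0 : Set (Set ℕ) :=
  {S : Set ℕ | Tendsto (fun n => (Nat.card ↥(S ∩ Set.Iio n) : ℝ) / n) atTop (𝓝 0)}

/-- `u(ℓ) := lim_k ‖{n : x n ∈ U_k}‖_φ` along a decreasing local base at `ℓ`;
its value is independent of the base and equals the infimum over all
neighborhoods. -/
noncomputable def uFun {X : Type*} [TopologicalSpace X] (φ : Set ℕ → ℝ≥0∞)
    (x : ℕ → X) (ℓ : X) : ℝ≥0∞ :=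
  ⨅ U ∈ 𝓝 ℓ, phiNorm φ {n | x n ∈ U}

/-- Isolated points of a set. -/
def isolatedPts {X : Type*} [TopologicalSpace X] (B : Set X) : Set X :=
  {b ∈ B | ∃ U ∈ 𝓝 b, U ∩ B = {b}}

theorem I0_mono {S T : Set ℕ} (h : S ⊆ T) (hT : T ∈ I0) : S ∈ I0 := by
  unfold I0 at *
  simp only [mem_setOf_eq] at *
  refine squeeze_zero (fun n => by positivity) (fun n => ?_) hT
  gcongr
  exact Nat.card_mono ((Set.finite_Iio n).subset inter_subset_right) (inter_subset_inter_left _ h)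

theorem I0_union {S T : Set ℕ} (hS : S ∈ I0) (hT : T ∈ I0) : S ∪ T ∈ I0 := by
  unfold I0 at *
  simp only [mem_setOf_eq] at *
  have := hS.add hT
  rw [add_zero] at this
  refine squeeze_zero (fun n => by positivity) (fun n => ?_) this
  rw [← add_div]
  gcongr
  rw [union_inter_distrib_right]
  have h := Set.ncard_union_le (S ∩ Iio n) (T ∩ Iio n)
  rw [Nat.card_coe_set_eq, Nat.card_coe_set_eq, Nat.card_coe_set_eq]
  exact_mod_cast h

theorem I0_finite {S : Set ℕ} (hS : S.Finite) : S ∈ I0 := by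
  unfold I0
  simp only [mem_setOf_eq]
  refine squeeze_zero (fun n => by positivity) (fun n => ?_)
    (tendsto_const_div_atTop_nhds_zero_nat (Nat.card S : ℝ))
  gcongr
  exact Nat.card_mono hS inter_subset_left

theorem card_mod_le (q r n : ℕ) (hq : 0 < q) :
    (Nat.card ↥({a | a % q = r} ∩ Set.Iio n) : ℝ) ≤ n / q + 1 := by
  have h : Nat.card ↥({a | a % q = r} ∩ Set.Iio n) ≤ n / q + 1 := by
    rw [Nat.card_coe_set_eq]
    have h1 : ({a | a % q = r} ∩ Set.Iio n) ⊆ (fun i => q * i + r) '' (Iio (n / q + 1)) := by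
      rintro a ⟨ha, han⟩
      simp only [mem_setOf_eq, mem_Iio] at ha han
      refine ⟨a / q, ?_, ?_⟩
      · simp only [mem_Iio]
        exact Nat.lt_succ_of_le (Nat.div_le_div_right han.le)
      · simp only [← ha]
        exact Nat.div_add_mod a q
    refine (Set.ncard_le_ncard h1 ((Set.finite_Iio _).image _)).trans ?_
    refine (Set.ncard_image_le (Set.finite_Iio _)).trans ?_
    simp [Set.ncard_eq_toFinset_card']
  calc (Nat.card ↥({a | a % q = r} ∩ Set.Iio n) : ℝ) ≤ ((n / q + 1 : ℕ) : ℝ) := by exact_mod_cast h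
    _ ≤ n / q + 1 := by push_cast; gcongr; exact Nat.cast_div_le

theorem I0_crit {S : Set ℕ} (h : ∀ k : ℕ, ∃ r, S \ {n | n % 2 ^ k = r} ∈ I0) : S ∈ I0 := by
  unfold I0
  simp only [mem_setOf_eq]
  rw [Metric.tendsto_atTop]
  intro ε hε
  obtain ⟨k, hk⟩ := exists_pow_lt_of_lt_one (show 0 < ε / 3 by positivity)
    (show (1 / 2 : ℝ) < 1 by norm_num)
  obtain ⟨r, hr⟩ := h k
  have h1 := (Metric.tendsto_atTop.1 hr) (ε / 3) (by positivity)
  obtain ⟨N, hN⟩ := h1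
  obtain ⟨M, hM⟩ := exists_nat_gt (3 / ε)
  refine ⟨max N (M + 1), fun n hn => ?_⟩
  have hn1 := hN n (le_trans (le_max_left _ _) hn)
  have hnM : (M : ℝ) + 1 ≤ n := by exact_mod_cast le_trans (le_max_right _ _) hn
  have hM0 : (0 : ℝ) ≤ M := by positivity
  have hn0 : (0 : ℝ) < n := by linarith
  rw [Real.dist_eq, sub_zero, abs_of_nonneg (by positivity)] at hn1 ⊢
  have hc : (Nat.card ↥(S ∩ Iio n) : ℝ) ≤ Nat.card ↥((S \ {n | n % 2 ^ k = r}) ∩ Iio n) +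
      Nat.card ↥({a | a % 2 ^ k = r} ∩ Set.Iio n) := by
    rw [Nat.card_coe_set_eq, Nat.card_coe_set_eq, Nat.card_coe_set_eq]
    have h2 : S ∩ Iio n ⊆ ((S \ {n | n % 2 ^ k = r}) ∩ Iio n) ∪ ({a | a % 2 ^ k = r} ∩ Set.Iio n) := by
      intro a ha
      by_cases hh : a % 2 ^ k = r
      · exact Or.inr ⟨hh, ha.2⟩
      · exact Or.inl ⟨⟨ha.1, hh⟩, ha.2⟩
    have h3 := (Set.ncard_le_ncard h2 (((Set.finite_Iio n).subset inter_subset_right).union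
      ((Set.finite_Iio n).subset inter_subset_right))).trans (Set.ncard_union_le _ _)
    exact_mod_cast h3
  have hq := card_mod_le (2 ^ k) r n (by positivity)
  have e1 : (n : ℝ) / ((2 ^ k : ℕ) : ℝ) < n * (ε / 3) := by
    have : (n : ℝ) / ((2 ^ k : ℕ) : ℝ) = n * (1 / 2) ^ k := by
      push_cast; rw [one_div, inv_pow]; rfl
    rw [this]
    gcongr
  have e2 : (1 : ℝ) < n * (ε / 3) := by
    have h4 : 3 / ε < n := by linarith
    rw [div_lt_iff₀ hε] at h4
    linarith
  rw [div_lt_iff₀ hn0] at hn1 ⊢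
  linarith

/-- powers of two -/
def Zpow : Set ℕ := Set.range (fun k : ℕ => 2 ^ k)

theorem Zpow_I0 : Zpow ∈ I0 := by
  refine I0_crit fun k => ⟨0, I0_finite ?_⟩
  refine ((Set.finite_Iio k).image (fun i => 2 ^ i)).subset ?_
  rintro _ ⟨⟨i, rfl⟩, hi⟩
  refine ⟨i, ?_, rfl⟩
  by_contra hik
  simp only [mem_Iio, not_lt] at hik
  exact hi (Nat.mod_eq_zero_of_dvd (pow_dvd_pow 2 hik))

theorem val_aux (m q : ℕ) : padicValNat 2 (2 ^ m * (2 * q + 1)) = m := by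
  haveI : Fact (Nat.Prime 2) := ⟨Nat.prime_two⟩
  rw [padicValNat.mul (by positivity) (by positivity), padicValNat.prime_pow,
    padicValNat.eq_zero_of_not_dvd (by omega), add_zero]

theorem block_not_I0 (m : ℕ) {K : Set ℕ} (hK : ∃ᶠ k in atTop, k ∈ K) :
    {n | padicValNat 2 n = m ∧ Nat.log 2 n ∈ K} ∉ I0 := by
  intro h
  have h1 := (Metric.tendsto_atTop.1 h) ((1 / 2) ^ (m + 2)) (by positivity)
  obtain ⟨N, hN⟩ := h1
  obtain ⟨k, hkN, hk⟩ := (frequently_atTop.1 hK) (N + m + 1)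
  have h2 := hN (2 ^ (k + 1)) (by
    have := Nat.lt_two_pow_self (n := k + 1)
    omega)
  rw [Real.dist_eq, sub_zero, abs_of_nonneg (by positivity)] at h2
  obtain ⟨t, rfl⟩ : ∃ t, k = m + 1 + t := ⟨k - (m + 1), by omega⟩
  have hc : 2 ^ t ≤ Nat.card ↥({n | padicValNat 2 n = m ∧ Nat.log 2 n ∈ K} ∩
      Iio (2 ^ (m + 1 + t + 1))) := by
    rw [Nat.card_coe_set_eq]
    have hs : (fun i => 2 ^ m * (2 * (2 ^ t + i) + 1)) '' (Iio (2 ^ t)) ⊆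
        {n | padicValNat 2 n = m ∧ Nat.log 2 n ∈ K} ∩ Iio (2 ^ (m + 1 + t + 1)) := by
      rintro _ ⟨i, hi, rfl⟩
      simp only [mem_Iio] at hi
      have hlt : 2 ^ m * (2 * (2 ^ t + i) + 1) < 2 ^ (m + 1 + t + 1) := by
        calc 2 ^ m * (2 * (2 ^ t + i) + 1) < 2 ^ m * (4 * 2 ^ t) := by
              gcongr; omega
          _ = _ := by ring
      have hge : 2 ^ (m + 1 + t) ≤ 2 ^ m * (2 * (2 ^ t + i) + 1) := by
        calc 2 ^ (m + 1 + t) = 2 ^ m * (2 * 2 ^ t) := by ring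
          _ ≤ _ := by gcongr; omega
      refine ⟨⟨val_aux _ _, ?_⟩, hlt⟩
      have : Nat.log 2 (2 ^ m * (2 * (2 ^ t + i) + 1)) = m + 1 + t :=
        Nat.log_eq_of_pow_le_of_lt_pow hge hlt
      simpa only [this] using hk
    have h3 := Set.ncard_le_ncard hs ((Set.finite_Iio _).subset inter_subset_right)
    rw [Set.ncard_image_of_injective] at h3
    · simpa [Set.ncard_eq_toFinset_card'] using h3
    · intro a b hab
      have : 2 * (2 ^ t + a) + 1 = 2 * (2 ^ t + b) + 1 :=
        Nat.eq_of_mul_eq_mul_left (by positivity) hab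
      omega
  have hc' : (2 : ℝ) ^ t ≤ (Nat.card ↥({n | padicValNat 2 n = m ∧ Nat.log 2 n ∈ K} ∩
      Iio (2 ^ (m + 1 + t + 1))) : ℝ) := by exact_mod_cast hc
  rw [div_lt_iff₀ (by positivity)] at h2
  have e : ((1 : ℝ) / 2) ^ (m + 2) * ((2 ^ (m + 1 + t + 1) : ℕ) : ℝ) = 2 ^ t := by
    push_cast
    rw [show m + 1 + t + 1 = (m + 2) + t by ring, pow_add 2 (m + 2) t, ← mul_assoc, ← mul_pow]
    norm_num
  rw [e] at h2
  linarith

theorem split_val {S : Set ℕ} (hS : S ∉ I0) : ∃ m, S ∩ {n | padicValNat 2 n = m} ∉ I0 := by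
  by_contra! hcon
  apply hS
  refine I0_crit fun k => ⟨0, ?_⟩
  have : ∀ k, S ∩ {n | padicValNat 2 n < k} ∈ I0 := by
    intro k
    induction k with
    | zero => simpa using I0_finite Set.finite_empty
    | succ k ih =>
      refine I0_mono ?_ (I0_union ih (hcon k))
      rintro a ⟨ha, hak⟩
      simp only [mem_setOf_eq] at hak
      rcases Nat.lt_succ_iff_lt_or_eq.1 hak with h | h
      · exact Or.inl ⟨ha, h⟩
      · exact Or.inr ⟨ha, h⟩
  refine I0_mono ?_ (this k)
  rintro a ⟨ha, hak⟩
  refine ⟨ha, ?_⟩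
  simp only [mem_setOf_eq] at hak ⊢
  by_contra! hh
  exact hak (Nat.mod_eq_zero_of_dvd ((pow_dvd_pow 2 hh).trans pow_padicValNat_dvd))

theorem neBot_of_not_I0 {S : Set ℕ} (hS : S ∉ I0) : NeBot (atTop ⊓ 𝓟 S) := by
  rw [← frequently_mem_iff_neBot, Nat.frequently_atTop_iff_infinite]
  exact fun h => hS (I0_finite h)

section
variable {X : Type*} [TopologicalSpace X] [PolishSpace X]

theorem exists_dense_rep {F : Set X} (hne : F.Nonempty) :
    ∃ d : ℕ → X, (∀ k, d k ∈ F) ∧ ∀ ℓ ∈ F, MapClusterPt ℓ atTop d := by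
  haveI : Nonempty F := hne.to_subtype
  haveI : SecondCountableTopology F := inferInstance
  obtain ⟨e, he⟩ := TopologicalSpace.exists_dense_seq F
  refine ⟨fun k => e k.unpair.1, fun k => (e _).2, fun ℓ hℓ => ?_⟩
  rw [mapClusterPt_iff_frequently]
  intro U hU
  have hU' : (Subtype.val ⁻¹' U : Set F) ∈ 𝓝 (⟨ℓ, hℓ⟩ : F) :=
    continuous_subtype_val.continuousAt.preimage_mem_nhds hU
  obtain ⟨i, hi⟩ := he.exists_mem_open isOpen_interior ⟨_, mem_interior_iff_mem_nhds.2 hU'⟩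
  rw [frequently_atTop]
  intro a
  refine ⟨Nat.pair i a, Nat.right_le_pair i a, ?_⟩
  have := interior_subset hi
  simpa using this

theorem exists_cantor (hperf : ∀ a : X, Filter.NeBot (𝓝[≠] a)) {V : Set X} (hV : IsOpen V)
    (hne : V.Nonempty) :
    ∃ y : ℕ → X, (∀ n, y n ∈ V) ∧ ∀ ℓ S, S ∉ I0 → ¬ Tendsto y (atTop ⊓ 𝓟 S) (𝓝 ℓ) := by
  letI := TopologicalSpace.upgradeIsCompletelyMetrizable X
  obtain ⟨v, hv⟩ := hne
  obtain ⟨K, hK, hKc, hKV⟩ := exists_mem_nhds_isClosed_subset (hV.mem_nhds hv)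
  have hpre : Preperfect (univ : Set X) := by
    intro a _
    rw [AccPt]
    simpa using hperf a
  have hW := (hpre.open_inter (isOpen_interior (s := K))).perfect_closure
  rw [inter_univ] at hW
  obtain ⟨f, hf, hfc, hfi⟩ := hW.exists_nat_bool_injection
    ⟨v, subset_closure (mem_interior_iff_mem_nhds.2 hK)⟩
  have hfV : ∀ z, f z ∈ V := fun z =>
    hKV ((closure_minimal interior_subset hKc) (hf ⟨z, rfl⟩))
  refine ⟨fun n => f (fun i => n.testBit i), fun n => hfV _, fun ℓ S hS hten => hS ?_⟩
  have hemb : IsClosedEmbedding f := hfc.isClosedEmbedding hfi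
  haveI := neBot_of_not_I0 hS
  obtain ⟨z, rfl⟩ : ℓ ∈ range f :=
    hemb.isClosed_range.mem_of_tendsto hten (Eventually.of_forall fun n => mem_range_self _)
  have hz : Tendsto (fun n : ℕ => (fun i => n.testBit i)) (atTop ⊓ 𝓟 S) (𝓝 z) :=
    (hemb.isEmbedding.tendsto_nhds_iff).2 hten
  rw [tendsto_pi_nhds] at hz
  refine I0_crit fun k => ?_
  have hev : ∀ᶠ n in atTop ⊓ 𝓟 S, ∀ i < k, Nat.testBit n i = z i := by
    refine ((Set.finite_Iio k).eventually_all (l := atTop ⊓ 𝓟 S)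
      (p := fun i n => Nat.testBit n i = z i)).2 fun i _ => ?_
    exact (hz i).eventually_mem (mem_nhds_discrete.2 (mem_singleton (z i)))
  obtain ⟨r, hr⟩ := hev.exists
  refine ⟨r % 2 ^ k, I0_finite ?_⟩
  rw [eventually_inf_principal, eventually_atTop] at hev
  obtain ⟨N, hN⟩ := hev
  refine (Set.finite_Iio N).subset ?_
  rintro a ⟨haS, ha⟩
  by_contra haN
  simp only [mem_Iio, not_lt] at haN
  apply ha
  have h2 := hN a haN haS
  refine Nat.eq_of_testBit_eq fun i => ?_
  rw [Nat.testBit_mod_two_pow, Nat.testBit_mod_two_pow]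
  by_cases hik : i < k
  · rw [h2 i hik, hr i hik]
  · simp [hik]

end

/-- in a Polish space without isolated points, any chain
`A ⊆ B ⊆ C` with `A` an `F_σ`-set, `B` non-empty regular closed, `C` closed, is
realized as statistical limit points, statistical cluster points, and ordinary
limit points of a single sequence. -/
theorem stmt15 {X : Type*} [TopologicalSpace X] [PolishSpace X]
    (hperf : ∀ a : X, Filter.NeBot (𝓝[≠] a))
    (A B C : Set X) (hAB : A ⊆ B) (hBC : B ⊆ C)
    (hAFσ : ∃ F : ℕ → Set X, (∀ n, IsClosed (F n)) ∧ A = ⋃ n, F n)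
    (hBne : B.Nonempty) (hBreg : closure (interior B) = B) (hC : IsClosed C) :
    ∃ x : ℕ → X, {ℓ : X | ILimitPoint I0 x ℓ} = A ∧
      {ℓ : X | IClusterPoint I0 x ℓ} = B ∧
      {ℓ : X | MapClusterPt ℓ atTop x} = C := by
  classical
  obtain ⟨F, hF, hAF⟩ := hAFσ
  have hBcl : IsClosed B := hBreg ▸ isClosed_closure
  have hint : (interior B).Nonempty := by
    rw [← closure_nonempty_iff, hBreg]; exact hBne
  obtain ⟨c, hcC, hc⟩ := exists_dense_rep (hBne.mono hBC)
  obtain ⟨b, hbc, hbne, hb⟩ := TopologicalSpace.exists_countable_basis X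
  obtain ⟨V, hV⟩ : ∃ V : ℕ → Set X, b = range V := by
    refine hbc.exists_eq_range ?_
    obtain ⟨a, -⟩ := hBne
    obtain ⟨v, hv, -⟩ := hb.exists_subset_of_mem_open (mem_univ a) isOpen_univ
    exact ⟨v, hv⟩
  -- odd columns
  have hodd : ∀ j, ∃ y : ℕ → X, (∀ n, y n ∈ B) ∧
      (∀ ℓ S, S ∉ I0 → ¬ Tendsto y (atTop ⊓ 𝓟 S) (𝓝 ℓ)) ∧
      ((V j ∩ B).Nonempty → ∀ n, y n ∈ V j) := by
    intro j
    have hVo : IsOpen (V j) := hb.isOpen (hV ▸ mem_range_self j)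
    by_cases h : (V j ∩ B).Nonempty
    · obtain ⟨a, ha, haB⟩ := h
      rw [← hBreg] at haB
      have hne : (V j ∩ interior B).Nonempty := mem_closure_iff.1 haB _ hVo ha
      obtain ⟨y, hy, hy2⟩ := exists_cantor hperf (hVo.inter isOpen_interior) hne
      exact ⟨y, fun n => interior_subset (hy n).2, hy2, fun _ n => (hy n).1⟩
    · obtain ⟨y, hy, hy2⟩ := exists_cantor hperf isOpen_interior hint
      exact ⟨y, fun n => interior_subset (hy n), hy2, fun h' => absurd h' h⟩
  -- even columns
  have heven : ∀ j, ∃ y : ℕ → X, (∀ n, y n ∈ B) ∧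
      (∀ ℓ S, S ∉ I0 → Tendsto y (atTop ⊓ 𝓟 S) (𝓝 ℓ) → ℓ ∈ A) ∧
      (∀ ℓ ∈ F j, ∃ K : Set ℕ, (∃ᶠ k in atTop, k ∈ K) ∧
        Tendsto y (atTop ⊓ 𝓟 {n | Nat.log 2 n ∈ K}) (𝓝 ℓ)) := by
    intro j
    have hFA : F j ⊆ A := hAF ▸ subset_iUnion F j
    by_cases h : (F j).Nonempty
    · obtain ⟨d, hd, hd2⟩ := exists_dense_rep h
      refine ⟨fun n => d (Nat.log 2 n), fun n => hAB (hFA (hd _)), fun ℓ S hS hten => ?_, ?_⟩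
      · haveI := neBot_of_not_I0 hS
        exact hFA ((hF j).mem_of_tendsto hten (Eventually.of_forall fun n => hd _))
      · intro ℓ hℓ
        obtain ⟨φ, hφ, hten⟩ := TopologicalSpace.FirstCountableTopology.tendsto_subseq (hd2 ℓ hℓ)
        refine ⟨range φ, ?_, ?_⟩
        · rw [Nat.frequently_atTop_iff_infinite]
          exact Set.infinite_range_of_injective hφ.injective
        · intro U hU
          rw [mem_map, mem_inf_principal]
          obtain ⟨i0, hi0⟩ := eventually_atTop.1 (hten.eventually_mem hU)
          have hlog : Tendsto (Nat.log 2) atTop atTop := by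
            refine tendsto_atTop.2 fun k => ?_
            filter_upwards [eventually_ge_atTop (2 ^ k)] with n hn
            exact Nat.le_log_of_pow_le (by norm_num) hn
          filter_upwards [hlog.eventually_ge_atTop (φ i0)] with n hn
          rintro ⟨i, hi⟩
          have : i0 ≤ i := hφ.le_iff_le.1 (hi ▸ hn)
          have := hi0 i this
          simpa only [mem_preimage, Function.comp, hi] using this
    · obtain ⟨y, hy, hy2⟩ := exists_cantor hperf isOpen_interior hint
      exact ⟨y, fun n => interior_subset (hy n), fun ℓ S hS hten => absurd hten (hy2 ℓ S hS),
        fun ℓ hℓ => absurd ⟨ℓ, hℓ⟩ h⟩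
  choose o ho1 ho2 ho3 using hodd
  choose e he1 he2 he3 using heven
  let y : ℕ → ℕ → X := fun m => if m % 2 = 0 then e (m / 2) else o (m / 2)
  have hye : ∀ j, y (2 * j) = e j := by
    intro j; simp [y]
  have hyo : ∀ j, y (2 * j + 1) = o j := by
    intro j
    have h1 : (2 * j + 1) / 2 = j := by omega
    simp [y, h1]
  have hyB : ∀ m n, y m n ∈ B := by
    intro m n
    rcases Nat.even_or_odd' m with ⟨j, rfl | rfl⟩
    · rw [hye]; exact he1 _ _
    · rw [hyo]; exact ho1 _ _
  have hyA : ∀ m ℓ S, S ∉ I0 → Tendsto (y m) (atTop ⊓ 𝓟 S) (𝓝 ℓ) → ℓ ∈ A := by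
    intro m ℓ S hS
    rcases Nat.even_or_odd' m with ⟨j, rfl | rfl⟩
    · rw [hye]; exact he2 _ _ _ hS
    · rw [hyo]; exact fun h => absurd h (ho2 _ _ _ hS)
  let x : ℕ → X := fun n => if n ∈ Zpow then c (Nat.log 2 n) else y (padicValNat 2 n) n
  have hxZ : ∀ n, n ∉ Zpow → x n = y (padicValNat 2 n) n := fun n hn => if_neg hn
  have hxC : ∀ n, x n ∈ C := by
    intro n
    by_cases hn : n ∈ Zpow
    · simp only [x, if_pos hn]; exact hcC _
    · rw [hxZ n hn]; exact hBC (hyB _ _)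
  have hdiff : ∀ S, S ∉ I0 → S \ Zpow ∉ I0 := by
    intro S hS h
    refine hS (I0_mono ?_ (I0_union h Zpow_I0))
    intro a ha
    by_cases haZ : a ∈ Zpow
    · exact Or.inr haZ
    · exact Or.inl ⟨ha, haZ⟩
  refine ⟨x, ?_, ?_, ?_⟩
  · ext ℓ
    constructor
    · rintro ⟨S, hS, hten⟩
      obtain ⟨m, hm⟩ := split_val hS
      refine hyA m ℓ _ (hdiff _ hm) ?_
      have h1 : Tendsto x (atTop ⊓ 𝓟 ((S ∩ {n | padicValNat 2 n = m}) \ Zpow)) (𝓝 ℓ) :=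
        hten.mono_left (inf_le_inf_left _ (principal_mono.2 fun a ha => ha.1.1))
      refine h1.congr' ?_
      rw [EventuallyEq, eventually_inf_principal]
      refine Eventually.of_forall fun n hn => ?_
      rw [hxZ n hn.2, show padicValNat 2 n = m from hn.1.2]
    · intro hℓ
      rw [hAF] at hℓ
      obtain ⟨j, hj⟩ := mem_iUnion.1 hℓ
      obtain ⟨K, hK, hten⟩ := he3 j ℓ hj
      refine ⟨_, hdiff _ (block_not_I0 (2 * j) hK), ?_⟩
      have h1 := hten.mono_left (inf_le_inf_left atTop (principal_mono.2
        (show {n | padicValNat 2 n = 2 * j ∧ Nat.log 2 n ∈ K} \ Zpow ⊆ {n | Nat.log 2 n ∈ K}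
          from fun a ha => ha.1.2)))
      refine h1.congr' ?_
      rw [EventuallyEq, eventually_inf_principal]
      refine Eventually.of_forall fun n hn => ?_
      rw [hxZ n hn.2, show padicValNat 2 n = 2 * j from hn.1.1, hye]
  · ext ℓ
    constructor
    · intro h
      by_contra hℓ
      refine h Bᶜ (hBcl.isOpen_compl.mem_nhds hℓ) (I0_mono ?_ Zpow_I0)
      intro n hn
      by_contra hnZ
      apply hn
      rw [hxZ n hnZ]
      exact hyB _ _
    · intro hℓ U hU h
      obtain ⟨v, hv, hℓv, hvU⟩ := hb.mem_nhds_iff.1 hU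
      rw [hV] at hv
      obtain ⟨j, rfl⟩ := hv
      refine hdiff _ (block_not_I0 (2 * j + 1) (K := univ)
        (Eventually.of_forall fun _ => mem_univ _).frequently) (I0_mono ?_ h)
      rintro n ⟨⟨hn, -⟩, hnZ⟩
      apply hvU
      rw [hxZ n hnZ, hn, hyo]
      exact ho3 j ⟨ℓ, hℓv, hℓ⟩ n
  · ext ℓ
    constructor
    · intro h
      by_contra hℓ
      have := (mapClusterPt_iff_frequently.1 h) Cᶜ (hC.isOpen_compl.mem_nhds hℓ)
      obtain ⟨n, hn⟩ := this.exists
      exact hn (hxC n)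
    · intro hℓ
      have h1 : x ∘ (fun k => 2 ^ k) = c := by
        funext k
        have : (2 ^ k : ℕ) ∈ Zpow := ⟨k, rfl⟩
        simp only [x, Function.comp, if_pos this]
        rw [Nat.log_pow (by norm_num)]
      have h2 := hc ℓ hℓ
      rw [← h1] at h2
      exact h2.of_comp (tendsto_pow_atTop_atTop_of_one_lt (by norm_num))
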